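/- Let b, d, e₀, s be natural numbers and X₁, X₂ natural numbers such that sin X₁ < sin X₂ and s ≤ d. Then there exist a natural number e and a nonempty open interval J ⊆ (sin X₁, sin X₂) such that e ≥ e₀, Next(b, e) holds, and for all natural numbers Z, if sin Z ∈ J then Best(d, e, X₁, Z, s) holds. -/

import Mathlib

/-- `Next X₁ X₂` holds iff `X₁ < X₂`, `sin X₁ < sin X₂`, and for every `Z < X₂`
either `sin Z ≤ sin X₁` or `sin X₂ < sin Z`. -/
def Next (X₁ X₂ : ℕ) : Prop :=
  X₁ < X₂ ∧ Real.sin X₁ < Real.sin X₂ ∧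
    ∀ Z : ℕ, Z < X₂ → Real.sin Z ≤ Real.sin X₁ ∨ Real.sin X₂ < Real.sin Z

/-- `g (X₁, X₂, Y₁, Y₂) = |sin X₂ − sin X₁ − |sin Y₂ − sin Y₁||`. -/
noncomputable def gFn (X₁ X₂ Y₁ Y₂ : ℕ) : ℝ :=
  abs (Real.sin X₂ - Real.sin X₁ - abs (Real.sin Y₂ - Real.sin Y₁))

/-- `Best d e X₁ X₂ Y₁` holds iff there is `Y₂` with `Y₁ ≤ d`, `Y₂ ≤ e`,
`Y₁ < Y₂`, and `g (X₁, X₂, Y₁, Y₂) < g (X₁, X₂, Z₁, Z₂)` for all `Z₁ ≤ d`,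
`Z₂ ≤ e` with `{Z₁, Z₂} ≠ {Y₁, Y₂}` as sets. -/
def Best (d e X₁ X₂ Y₁ : ℕ) : Prop :=
  ∃ Y₂ : ℕ, Y₁ ≤ d ∧ Y₂ ≤ e ∧ Y₁ < Y₂ ∧
    ∀ Z₁ Z₂ : ℕ, Z₁ ≤ d → Z₂ ≤ e → ({Z₁, Z₂} : Set ℕ) ≠ {Y₁, Y₂} →
      gFn X₁ X₂ Y₁ Y₂ < gFn X₁ X₂ Z₁ Z₂

open Polynomial Filter Topology

/-- Hermite's argument over the Gaussian integers. -/
theorem aeval_exp_I_ne_zero_of_coeff_zero_ne_zero {P : ℤ[X]} (h0 : P.coeff 0 ≠ 0) :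
    aeval (Complex.exp Complex.I) P ≠ 0 := by
  intro hP
  set N := P.natDegree with hN
  set f : ℤ[X] := ∏ k ∈ Finset.range N, (X ^ 2 + C (((k : ℤ) + 1) ^ 2)) with hf
  have hf0 : f.eval 0 ≠ 0 := by
    rw [hf, eval_prod, Finset.prod_ne_zero_iff]
    intro k _
    simp
    positivity
  have hfne : f ≠ 0 := by
    rintro h
    simp [h] at hf0
  have hroot : ∀ k ∈ Finset.range N, ((k + 1 : ℕ) * Complex.I : ℂ) ∈ f.aroots ℂ := by
    intro k hk
    rw [mem_aroots]
    refine ⟨hfne, ?_⟩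
    rw [hf, map_prod]
    refine Finset.prod_eq_zero hk ?_
    simp [mul_pow]
  obtain ⟨c, hc⟩ := LindemannWeierstrass.exp_polynomial_approx f hf0
  set A : ℝ := ∑ k ∈ Finset.range N, |(P.coeff (k + 1) : ℝ)| with hA
  have hlim : Tendsto (fun m : ℕ ↦ A * c * (c ^ m / (m.factorial : ℝ))) atTop (𝓝 0) := by
    simpa using (FloorSemiring.tendsto_pow_div_factorial_atTop c).const_mul (A * c)
  obtain ⟨M, hM⟩ := eventually_atTop.1 (hlim.eventually_lt_const one_pos)
  obtain ⟨p, hp, hprime⟩ :=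
    Nat.exists_infinite_primes (M + (eval 0 f).natAbs + (P.coeff 0).natAbs + 2)
  obtain ⟨n, hn, gp, -, hgp⟩ := hc p (by omega) hprime
  let w : GaussianInt := ∑ k ∈ Finset.range N,
    (P.coeff (k + 1) : GaussianInt) * aeval (⟨0, k + 1⟩ : GaussianInt) gp
  have hw : (w : ℂ) = ∑ k ∈ Finset.range N,
      (P.coeff (k + 1) : ℂ) * aeval ((k + 1 : ℕ) * Complex.I : ℂ) gp := by
    simp only [w, map_sum, map_mul, map_intCast]
    refine Finset.sum_congr rfl fun k _ ↦ ?_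
    congr 1
    have h1 : ((k + 1 : ℕ) * Complex.I : ℂ) =
        GaussianInt.toComplex (⟨0, k + 1⟩ : GaussianInt) := by
      simp [GaussianInt.toComplex_def]
    rw [h1]
    exact (aeval_algHom_apply GaussianInt.toComplex.toIntAlgHom _ gp).symm
  have hsum : ∑ k ∈ Finset.range N, (P.coeff (k + 1) : ℂ) *
        Complex.exp ((k + 1 : ℕ) * Complex.I) = -(P.coeff 0 : ℂ) := by
    rw [aeval_eq_sum_range, Finset.sum_range_succ'] at hP
    simp only [pow_zero, ← Complex.exp_nat_mul, zsmul_eq_mul, mul_one] at hP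
    exact eq_neg_of_add_eq_zero_left hP
  have hkey : ∑ k ∈ Finset.range N, (P.coeff (k + 1) : ℂ) *
      (n • Complex.exp ((k + 1 : ℕ) * Complex.I)
        - p • aeval ((k + 1 : ℕ) * Complex.I : ℂ) gp) =
      ((-(n * P.coeff 0) : ℤ) : ℂ) - p * (w : ℂ) := by
    rw [hw]
    simp only [zsmul_eq_mul, nsmul_eq_mul, mul_sub, Finset.sum_sub_distrib]
    congr 1
    · push_cast
      rw [← mul_neg, ← hsum, Finset.mul_sum]
      push_cast
      exact Finset.sum_congr rfl fun k _ ↦ by ring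
    · rw [Finset.mul_sum]
      exact Finset.sum_congr rfl fun k _ ↦ by ring
  have hsmall : ‖((-(n * P.coeff 0) : ℤ) : ℂ) - p * (w : ℂ)‖ < 1 := by
    rw [← hkey]
    calc _ ≤ ∑ k ∈ Finset.range N,
          |(P.coeff (k + 1) : ℝ)| * (c ^ p / ((p - 1).factorial : ℝ)) := by
          refine norm_sum_le_of_le _ fun k hk ↦ ?_
          rw [norm_mul, Complex.norm_intCast]
          exact mul_le_mul_of_nonneg_left (hgp (hroot k hk)) (abs_nonneg _)
      _ = A * c * (c ^ (p - 1) / ((p - 1).factorial : ℝ)) := by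
          rw [← Finset.sum_mul, ← hA]
          obtain ⟨q, rfl⟩ : ∃ q, p = q + 1 := ⟨p - 1, by omega⟩
          simp only [Nat.add_sub_cancel, pow_succ]
          ring
      _ < 1 := hM (p - 1) (by omega)
  have hre : |((-(n * P.coeff 0) - p * w.re : ℤ) : ℝ)| < 1 := by
    have hcast : ((-(n * P.coeff 0) : ℤ) : ℂ) - p * (w : ℂ) =
        ((-(n * P.coeff 0) - p * w.re : ℤ) : ℂ) - ((p * w.im : ℤ) : ℂ) * Complex.I := by
      rw [GaussianInt.toComplex_def]
      push_cast
      ring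
    rw [hcast] at hsmall
    simpa only [Complex.sub_re, Complex.mul_I_re, Complex.intCast_re, Complex.intCast_im, neg_zero,
      sub_zero] using (Complex.abs_re_le_norm _).trans_lt hsmall
  have hzero : -(n * P.coeff 0) - p * w.re = 0 := by
    rw [← Int.abs_lt_one_iff]
    exact_mod_cast hre
  have hdvd : (p : ℤ) ∣ n * P.coeff 0 := ⟨-w.re, by linarith⟩
  rcases (Nat.prime_iff_prime_int.1 hprime).dvd_or_dvd hdvd with h | h
  · exact hn h
  · have := Int.natAbs_le_of_dvd_ne_zero h h0
    simp at this
    omega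

theorem transcendental_exp_I : Transcendental ℤ (Complex.exp Complex.I) := by
  rw [transcendental_iff]
  intro P hP
  by_contra hne
  obtain ⟨Q, hQ, hndvd⟩ := exists_eq_pow_rootMultiplicity_mul_and_not_dvd P hne 0
  rw [C_0, sub_zero, X_dvd_iff] at hndvd
  refine aeval_exp_I_ne_zero_of_coeff_zero_ne_zero hndvd ?_
  rw [hQ] at hP
  simpa [Complex.exp_ne_zero] using hP

/-- A difference of two distinct values of `sin` at naturals determines both arguments. -/
theorem eq_and_eq_of_sin_sub_sin_eq {a b c d : ℕ} (hab : a ≠ b)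
    (h : Real.sin a - Real.sin b = Real.sin c - Real.sin d) : a = c ∧ b = d := by
  set N := a + b + c + d with hN
  set z := Complex.exp Complex.I with hz
  have hz0 : z ≠ 0 := Complex.exp_ne_zero _
  have hpow : ∀ k ≤ N, z ^ (N + k) - z ^ (N - k) = z ^ N * (2 * Complex.I * Real.sin k) := by
    intro k hk
    have h1 : z ^ (N - k) = z ^ N * Complex.exp (-(k : ℂ) * Complex.I) := by
      rw [pow_sub₀ _ hz0 hk, hz, ← Complex.exp_nat_mul _ k, ← Complex.exp_neg, neg_mul]
    have h2 : z ^ (N + k) = z ^ N * Complex.exp ((k : ℂ) * Complex.I) := by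
      rw [pow_add, hz, ← Complex.exp_nat_mul _ k]
    rw [h1, h2, Complex.ofReal_sin, Complex.sin]
    push_cast
    ring_nf
    rw [Complex.I_sq]
    ring
  let Q : ℤ[X] := (X ^ (N + a) - X ^ (N - a)) - (X ^ (N + b) - X ^ (N - b))
    - (X ^ (N + c) - X ^ (N - c)) + (X ^ (N + d) - X ^ (N - d))
  have hQ : aeval z Q = 0 := by
    simp only [Q, map_sub, map_add, map_pow, aeval_X]
    rw [hpow a (by omega), hpow b (by omega), hpow c (by omega), hpow d (by omega)]
    have h' : (Real.sin a : ℂ) - Real.sin b = Real.sin c - Real.sin d := by exact_mod_cast h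
    linear_combination (z ^ N * (2 * Complex.I)) * h'
  have hQ0 : Q = 0 := (transcendental_iff.1 transcendental_exp_I) Q hQ
  have hcoeff : ∀ m, Q.coeff m = 0 := fun m ↦ by rw [hQ0, coeff_zero]
  have heq : ∀ k, k ≠ 0 → (if k = a then (1 : ℤ) else 0) - (if k = b then 1 else 0)
      - (if k = c then 1 else 0) + (if k = d then 1 else 0) = 0 := by
    intro k hk
    have hne : ∀ j, N + k ≠ N - j := fun j ↦ by omega
    simpa [Q, coeff_X_pow, hne] using hcoeff (N + k)
  have ha := heq a
  have hb := heq b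
  have hc := heq c
  have hd := heq d
  clear heq hcoeff hQ0 hQ hpow h
  clear_value Q
  grind

theorem sin_natCast_lt_one (n : ℕ) : Real.sin n < 1 := by
  refine lt_of_le_of_ne (Real.sin_le_one _) fun h ↦ ?_
  obtain ⟨k, hk⟩ := Real.sin_eq_one_iff.1 h
  refine irrational_pi ⟨2 * n / (1 + 4 * k), ?_⟩
  have h1 : (1 + 4 * (k : ℝ)) ≠ 0 := by
    have : (1 + 4 * k : ℤ) ≠ 0 := by omega
    exact_mod_cast this
  push_cast
  rw [div_eq_iff h1, ← hk]
  ring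

/-- The values of `sin` at large naturals are dense in `[-1, 1]`. -/
theorem exists_gt_sin_mem_Ioo {u v : ℝ} (hu : -1 ≤ u) (hv : v ≤ 1) (huv : u < v) (N : ℕ) :
    ∃ n : ℕ, N < n ∧ Real.sin n ∈ Set.Ioo u v := by
  have : Fact (0 < 2 * Real.pi) := ⟨by positivity⟩
  have hirr : Irrational ((1 : ℝ) / (2 * Real.pi)) := by
    rw [one_div, irrational_inv_iff]
    exact_mod_cast irrational_pi.natCast_mul (m := 2) (by norm_num)
  have hdense := AddCircle.denseRange_zsmul_coe_iff.2 hirr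
  set x := (u + v) / 2 with hx
  let y : AddCircle (2 * Real.pi) := (Real.arcsin x : ℝ)
  have hcl : MapClusterPt y atTop
      (fun n : ℕ ↦ n • ((1 : ℝ) : AddCircle (2 * Real.pi))) :=
    ((mapClusterPt_atTop_nsmul_tfae y _).out 0 3).2 (hdense y)
  have hcont : Continuous (Real.sin_periodic.lift : AddCircle (2 * Real.pi) → ℝ) :=
    Real.continuous_sin.quotient_lift _
  have hmem : ∀ᶠ t in 𝓝 y, Real.sin_periodic.lift t ∈ Set.Ioo u v := by
    refine hcont.continuousAt.eventually_mem (isOpen_Ioo.mem_nhds ?_)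
    simp only [y, Function.Periodic.lift_coe]
    rw [Real.sin_arcsin (by linarith) (by linarith)]
    constructor <;> linarith
  obtain ⟨n, hn, hNn⟩ := ((hcl.frequently hmem).and_eventually (eventually_gt_atTop N)).exists
  refine ⟨n, hNn, ?_⟩
  rw [← AddCircle.coe_nsmul, Function.Periodic.lift_coe] at hn
  simpa using hn

theorem exists_next_ge (b M : ℕ) : ∃ e, M ≤ e ∧ Next b e := by
  have hev : ∀ᶠ m in 𝓝[>] Real.sin b, ∀ Z ∈ Finset.range (max M b + 1),
      Real.sin b < Real.sin Z → m ≤ Real.sin Z := by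
    rw [Finset.eventually_all]
    intro Z _
    by_cases hZ : Real.sin b < Real.sin Z
    · filter_upwards [Ioo_mem_nhdsGT hZ] with m hm _ using hm.2.le
    · exact Eventually.of_forall fun m h ↦ absurd h hZ
  obtain ⟨m, hm, hbm, hm1⟩ :=
    (hev.and (Ioo_mem_nhdsGT (sin_natCast_lt_one b))).exists
  have hex : ∃ e : ℕ, Real.sin e ∈ Set.Ioo (Real.sin b) m := by
    obtain ⟨e, -, he⟩ := exists_gt_sin_mem_Ioo (Real.neg_one_le_sin b) hm1.le hbm 0
    exact ⟨e, he⟩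
  classical
  have he := Nat.find_spec hex
  have hgt : max M b < Nat.find hex := by
    by_contra! hle
    exact absurd (hm _ (Finset.mem_range.2 (by omega)) he.1) (not_le.2 he.2)
  refine ⟨Nat.find hex, by omega, by omega, he.1, fun Z hZ ↦ ?_⟩
  by_contra! hcon
  exact Nat.find_min hex hZ ⟨hcon.1, hcon.2.trans_lt he.2⟩

/-- **Lemma 3.12.** Let `b, d, e₀, s` be naturals and `X₁, X₂` naturals with
`sin X₁ < sin X₂` and `s ≤ d`.  Then there are `e ≥ e₀` with `Next b e` and a
nonempty open interval `J ⊆ (sin X₁, sin X₂)` such that every natural `Z` with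
`sin Z ∈ J` satisfies `Best d e X₁ Z s`. -/
theorem exists_best_interval (b d e₀ s X₁ X₂ : ℕ)
    (hsin : Real.sin X₁ < Real.sin X₂) (hsd : s ≤ d) :
    ∃ (e : ℕ) (u v : ℝ), u < v ∧
      Set.Ioo u v ⊆ Set.Ioo (Real.sin X₁) (Real.sin X₂) ∧
      e ≥ e₀ ∧ Next b e ∧
      ∀ Z : ℕ, Real.sin Z ∈ Set.Ioo u v → Best d e X₁ Z s := by
  obtain ⟨Y, hsY, hY1, hY2⟩ := exists_gt_sin_mem_Ioo (u := Real.sin s)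
    (v := min 1 (Real.sin s + (Real.sin X₂ - Real.sin X₁))) (Real.neg_one_le_sin s)
    (min_le_left _ _) (lt_min (sin_natCast_lt_one s) (by linarith)) s
  replace hY2 := hY2.trans_le (min_le_right _ _)
  obtain ⟨e, he, hnext⟩ := exists_next_ge b (max e₀ Y)
  set t := Real.sin Y - Real.sin s with ht
  have hne : ∀ Z₁ Z₂ : ℕ, ({Z₁, Z₂} : Set ℕ) ≠ {s, Y} →
      0 < |t - (|Real.sin Z₂ - Real.sin Z₁|)| := by
    intro Z₁ Z₂ hZ
    rw [abs_pos, sub_ne_zero]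
    intro h
    rcases abs_choice (Real.sin Z₂ - Real.sin Z₁) with h' | h' <;> rw [h'] at h
    · obtain ⟨rfl, rfl⟩ := eq_and_eq_of_sin_sub_sin_eq hsY.ne' h
      exact hZ rfl
    · rw [neg_sub] at h
      obtain ⟨rfl, rfl⟩ := eq_and_eq_of_sin_sub_sin_eq hsY.ne' h
      exact hZ (Set.pair_comm _ _)
  have hev : ∀ᶠ η in 𝓝[>] (0 : ℝ), ∀ Z ∈ Finset.range (d + 1) ×ˢ Finset.range (e + 1),
      ({Z.1, Z.2} : Set ℕ) ≠ {s, Y} → 2 * η ≤ |t - (|Real.sin Z.2 - Real.sin Z.1|)| := by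
    rw [Finset.eventually_all]
    intro Z _
    by_cases hZ : ({Z.1, Z.2} : Set ℕ) ≠ {s, Y}
    · filter_upwards [Ioo_mem_nhdsGT (half_pos (hne _ _ hZ))] with η hη _
      linarith [hη.2]
    · exact Eventually.of_forall fun η h ↦ absurd h hZ
  have hpos : 0 < min t (Real.sin X₂ - Real.sin X₁ - t) := lt_min (by linarith) (by linarith)
  obtain ⟨η, hη, hη0, hη1⟩ := (hev.and (Ioo_mem_nhdsGT hpos)).exists
  have hηt := hη1.trans_le (min_le_left _ _)
  have hηX := hη1.trans_le (min_le_right _ _)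
  refine ⟨e, Real.sin X₁ + t - η, Real.sin X₁ + t + η, by linarith,
    Set.Ioo_subset_Ioo (by linarith) (by linarith), by omega, hnext, fun Z hZ ↦ ?_⟩
  refine ⟨Y, hsd, by omega, hsY, fun Z₁ Z₂ hZ₁ hZ₂ hpair ↦ ?_⟩
  have hgap : 2 * η ≤ |t - (|Real.sin Z₂ - Real.sin Z₁|)| :=
    hη (Z₁, Z₂) (by simp; omega) hpair
  have hclose : |Real.sin Z - Real.sin X₁ - t| < η :=
    abs_lt.2 ⟨by linarith [hZ.1], by linarith [hZ.2]⟩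
  have habs : |Real.sin Y - Real.sin s| = t := abs_of_pos (by linarith)
  have htri := abs_sub_le t (Real.sin Z - Real.sin X₁) |Real.sin Z₂ - Real.sin Z₁|
  rw [abs_sub_comm t (Real.sin Z - Real.sin X₁)] at htri
  unfold gFn
  rw [habs]
  linarith
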